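/- For every integer r ≥ 1 and every n ≥ 1, the pairs (rdes, rmaj) and (rexc, rden) are equidistributed over S_n; that is, for all integers a, b, the number of σ ∈ S_n with rdes(σ) = a and rmaj(σ) = b equals the number of σ ∈ S_n with rexc(σ) = a and rden(σ) = b. -/

import Mathlib

open Finset

namespace PaperStmt

/-- 1-based position of `i : Fin n` (so positions run through `1,…,n`). -/
def pos1 {n : ℕ} (i : Fin n) : ℕ := (i : ℕ) + 1

/-- 1-based value `σ_i` of the permutation `σ` at position `i`. -/
def val1 {n : ℕ} (σ : Equiv.Perm (Fin n)) (i : Fin n) : ℕ := (σ i : ℕ) + 1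

/-- The number of inversions of the subsequence of `σ` consisting of the letters at the
positions satisfying `P`: pairs of positions `i < j`, both satisfying `P`,
with `σ_i > σ_j`. -/
def invOn {n : ℕ} (σ : Equiv.Perm (Fin n)) (P : Fin n → Prop) [DecidablePred P] : ℕ :=
  (univ.filter fun p : Fin n × Fin n =>
    p.1 < p.2 ∧ P p.1 ∧ P p.2 ∧ val1 σ p.2 < val1 σ p.1).card

/-- `inv σ`: the number of inversions of `σ`. -/
def inv {n : ℕ} (σ : Equiv.Perm (Fin n)) : ℕ := invOn σ (fun _ => True)

/-- `Exc(σ)`: the set of excedances, i.e. positions `i` with `σ_i > i`. -/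
def excSet {n : ℕ} (σ : Equiv.Perm (Fin n)) : Finset (Fin n) :=
  univ.filter fun i => pos1 i < val1 σ i

/-- `exc σ`: the number of excedances. -/
def exc {n : ℕ} (σ : Equiv.Perm (Fin n)) : ℕ := (excSet σ).card

/-- `exc_r(σ)`: the number of `r`-level excedances, i.e. positions `i ≥ r` with `σ_i > i`. -/
def excLvl {n : ℕ} (r : ℕ) (σ : Equiv.Perm (Fin n)) : ℕ :=
  (univ.filter fun i => pos1 i < val1 σ i ∧ r ≤ pos1 i).card

/-- Denert's statistic `den σ`. -/
def den {n : ℕ} (σ : Equiv.Perm (Fin n)) : ℕ :=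
  ((univ.filter fun i => pos1 i < val1 σ i).sum pos1)
  + invOn σ (fun i => pos1 i < val1 σ i)
  + invOn σ (fun i => ¬ pos1 i < val1 σ i)

/-- The `h`-level Denert statistic `den_h(σ)`. -/
def denLvl {n : ℕ} (h : ℕ) (σ : Equiv.Perm (Fin n)) : ℕ :=
  ((univ.filter fun i => pos1 i < val1 σ i ∧ h ≤ val1 σ i).sum pos1)
  + invOn σ (fun i => pos1 i < val1 σ i ∧ h ≤ val1 σ i)
  + invOn σ (fun i => ¬ (pos1 i < val1 σ i ∧ h ≤ val1 σ i))

/-- `g exc_ℓ(σ)`: the number of `g`-gap `ℓ`-level excedances,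
i.e. positions `i ≥ ℓ` with `σ_i ≥ i + g`. -/
def gexc {n : ℕ} (g l : ℕ) (σ : Equiv.Perm (Fin n)) : ℕ :=
  (univ.filter fun i => pos1 i + g ≤ val1 σ i ∧ l ≤ pos1 i).card

/-- `gExclp_h(σ)`: the set of `g`-gap `h`-level excedance-letter positions,
i.e. positions `i` with `σ_i ≥ i + g` and `σ_i ≥ h`. -/
def gExclpSet {n : ℕ} (g h : ℕ) (σ : Equiv.Perm (Fin n)) : Finset (Fin n) :=
  univ.filter fun i => pos1 i + g ≤ val1 σ i ∧ h ≤ val1 σ i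

/-- The `g`-gap `h`-level Denert statistic `g den_h(σ)`. -/
def gden {n : ℕ} (g h : ℕ) (σ : Equiv.Perm (Fin n)) : ℕ :=
  ((univ.filter fun i => pos1 i + g ≤ val1 σ i ∧ h ≤ val1 σ i).sum fun i => pos1 i + g - 1)
  + invOn σ (fun i => pos1 i + g ≤ val1 σ i ∧ h ≤ val1 σ i)
  + invOn σ (fun i => ¬ (pos1 i + g ≤ val1 σ i ∧ h ≤ val1 σ i))

/-- `rexc σ`: the number of `r`-excedances, i.e. positions `i` with `σ_i ≥ i + r`. -/
def rexc {n : ℕ} (r : ℕ) (σ : Equiv.Perm (Fin n)) : ℕ :=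
  (univ.filter fun i => pos1 i + r ≤ val1 σ i).card

/-- The `r`-Denert statistic `rden σ`. -/
def rden {n : ℕ} (r : ℕ) (σ : Equiv.Perm (Fin n)) : ℕ :=
  ((univ.filter fun i => pos1 i + r ≤ val1 σ i).sum fun i => pos1 i + r - 1)
  + invOn σ (fun i => pos1 i + r ≤ val1 σ i)
  + invOn σ (fun i => ¬ pos1 i + r ≤ val1 σ i)

/-- Pairs `(i, i+1)` of adjacent positions forming an `r`-descent: `σ_i ≥ σ_{i+1} + r`. -/
def rdesPairs {n : ℕ} (r : ℕ) (σ : Equiv.Perm (Fin n)) : Finset (Fin n × Fin n) :=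
  univ.filter fun p => pos1 p.2 = pos1 p.1 + 1 ∧ val1 σ p.2 + r ≤ val1 σ p.1

/-- `rdes σ`: the number of `r`-descents. -/
def rdes {n : ℕ} (r : ℕ) (σ : Equiv.Perm (Fin n)) : ℕ := (rdesPairs r σ).card

/-- `rmaj σ`: the sum of the `r`-descents plus the number of pairs `i < j`
with `σ_j < σ_i < σ_j + r`. -/
def rmaj {n : ℕ} (r : ℕ) (σ : Equiv.Perm (Fin n)) : ℕ :=
  ((rdesPairs r σ).sum fun p => pos1 p.1)
  + (univ.filter fun p : Fin n × Fin n =>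
      p.1 < p.2 ∧ val1 σ p.2 < val1 σ p.1 ∧ val1 σ p.1 < val1 σ p.2 + r).card

/-- `des σ`: the number of descents, i.e. positions `i ∈ [n-1]` with `σ_i > σ_{i+1}`. -/
def des {n : ℕ} (σ : Equiv.Perm (Fin n)) : ℕ :=
  (univ.filter fun p : Fin n × Fin n =>
    pos1 p.2 = pos1 p.1 + 1 ∧ val1 σ p.2 < val1 σ p.1).card

/-- `maj σ`: the major index, i.e. the sum of the descents of `σ`. -/
def maj {n : ℕ} (σ : Equiv.Perm (Fin n)) : ℕ :=
  ((univ.filter fun p : Fin n × Fin n =>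
    pos1 p.2 = pos1 p.1 + 1 ∧ val1 σ p.2 < val1 σ p.1).sum fun p => pos1 p.1)

/-- Inserting at the slot `p` creates a new descent or excedance: `p` is neither the last slot nor
a slot of `Q`. -/
def Raises {n : ℕ} (Q : Finset (Fin n)) (p : Fin (n + 1)) : Prop :=
  ∃ j, j ∉ Q ∧ j.castSucc = p

instance {n : ℕ} (Q : Finset (Fin n)) (p : Fin (n + 1)) : Decidable (Raises Q p) :=
  inferInstanceAs (Decidable (∃ j, j ∉ Q ∧ j.castSucc = p))

/-- The increment of the Mahonian statistic caused by an insertion at the slot `p`. -/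
def slotCode {n : ℕ} (Q : Finset (Fin n)) (p : Fin (n + 1)) : ℕ :=
  #(Q.filter fun j : Fin n => (p : ℕ) ≤ j) + if Raises Q p then (p : ℕ) + 1 else 0

theorem card_le_of_forall_mem_Ico {n : ℕ} (S : Finset (Fin n)) (a b : ℕ)
    (h : ∀ j ∈ S, a ≤ (j : ℕ) ∧ (j : ℕ) < b) : #S ≤ b - a := by
  rw [← Nat.card_Ico]
  exact card_le_card_of_injOn (fun j => (j : ℕ)) (by intro j hj; simpa using h j hj)
    (fun i _ j _ hij => Fin.ext hij)

theorem card_filter_le_eq_add {n : ℕ} (Q : Finset (Fin n)) {a b : ℕ} (hab : a ≤ b) :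
    #(Q.filter fun j : Fin n => a ≤ (j : ℕ)) =
      #(Q.filter fun j : Fin n => a ≤ (j : ℕ) ∧ (j : ℕ) < b)
        + #(Q.filter fun j : Fin n => b ≤ (j : ℕ)) := by
  rw [← card_union_of_disjoint]
  · congr 1
    ext j
    simp only [mem_filter, mem_union]
    grind
  · rw [disjoint_filter]
    intro j _ h1 h2
    omega

theorem slotCode_lt_iff {n : ℕ} (Q : Finset (Fin n)) (p : Fin (n + 1)) :
    slotCode Q p < #Q + 1 ↔ ¬ Raises Q p := by
  unfold slotCode
  split_ifs with h
  · have h0 := card_filter_le_eq_add Q (Nat.zero_le (p : ℕ))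
    have h1 := card_le_of_forall_mem_Ico (Q.filter fun j : Fin n => 0 ≤ (j : ℕ) ∧ (j : ℕ) < p) 0 p
      (by intro j hj; simpa using (mem_filter.1 hj).2)
    simp only [Nat.zero_le, true_and, filter_true] at h0 h1
    simp only [h, not_true, iff_false]
    omega
  · have := card_filter_le Q (fun j : Fin n => (p : ℕ) ≤ j)
    simp only [h, not_false_eq_true, iff_true]
    omega

theorem slotCode_lt {n : ℕ} (Q : Finset (Fin n)) (p : Fin (n + 1)) : slotCode Q p < n + 1 := by
  by_cases h : Raises Q p
  · obtain ⟨k, hk, rfl⟩ := id h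
    have := card_le_of_forall_mem_Ico (Q.filter fun j : Fin n => (k : ℕ) ≤ j) (k + 1) n (by
      intro j hj
      rw [mem_filter] at hj
      have : j ≠ k := fun e => hk (e ▸ hj.1)
      have : (j : ℕ) ≠ k := fun e => this (Fin.ext e)
      omega)
    simp only [slotCode, h, if_true, Fin.val_castSucc]
    omega
  · have h1 := (slotCode_lt_iff Q p).2 h
    have h2 : #Q ≤ n := by simpa using card_le_univ Q
    omega

theorem slotCode_ne_of_lt {n : ℕ} (Q : Finset (Fin n)) {p q : Fin (n + 1)} (hpq : p < q) :
    slotCode Q p ≠ slotCode Q q := by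
  intro he
  have hr : Raises Q p ↔ Raises Q q := by
    rw [← not_iff_not, ← slotCode_lt_iff, ← slotCode_lt_iff, he]
  have hpq' : (p : ℕ) < q := hpq
  have hq := q.isLt
  have hsplit := card_filter_le_eq_add Q hpq'.le
  by_cases h : Raises Q p
  · simp only [slotCode, h, hr.1 h, if_true] at he
    obtain ⟨k, hk, rfl⟩ := h
    have := card_le_of_forall_mem_Ico
      (Q.filter fun j : Fin n => (k : ℕ) ≤ j ∧ (j : ℕ) < q) (k + 1) q (by
      intro j hj
      rw [mem_filter] at hj
      have : j ≠ k := fun e => hk (e ▸ hj.1)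
      have : (j : ℕ) ≠ k := fun e => this (Fin.ext e)
      omega)
    simp only [Fin.val_castSucc] at *
    omega
  · have h' : ¬ Raises Q q := fun h2 => h (hr.2 h2)
    simp only [slotCode, h, h', if_false] at he
    have hk : (⟨p, by omega⟩ : Fin n) ∈ Q := by
      by_contra hk
      exact h ⟨_, hk, rfl⟩
    have : 0 < #(Q.filter fun j : Fin n => (p : ℕ) ≤ j ∧ (j : ℕ) < q) :=
      card_pos.2 ⟨_, mem_filter.2 ⟨hk, le_refl _, hpq'⟩⟩
    omega

theorem slotCode_injective {n : ℕ} (Q : Finset (Fin n)) : Function.Injective (slotCode Q) := by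
  intro p q h
  rcases lt_trichotomy p q with hpq | hpq | hpq
  · exact absurd h (slotCode_ne_of_lt Q hpq)
  · exact hpq
  · exact absurd h.symm (slotCode_ne_of_lt Q hpq)

theorem sum_slotCode {n : ℕ} (Q : Finset (Fin n)) (G : ℕ → ℕ) :
    ∑ p, G (slotCode Q p) = ∑ c ∈ range (n + 1), G c := by
  have himage : univ.image (slotCode Q) = range (n + 1) := by
    apply eq_of_subset_of_card_le
    · intro c hc
      obtain ⟨p, -, rfl⟩ := mem_image.1 hc
      exact mem_range.2 (slotCode_lt Q p)
    · rw [card_image_of_injective _ (slotCode_injective Q)]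
      simp
  rw [← himage, sum_image (slotCode_injective Q).injOn]

/-- The Rawlings recursion: a family of insertions that changes a pair of statistics according to
`slotCode` determines the distribution of the pair on `S_{n+1}` from the one on `S_n`. -/
theorem sum_stat_succ {n s : ℕ} (st : Equiv.Perm (Fin n) → ℕ × ℕ)
    (st' : Equiv.Perm (Fin (n + 1)) → ℕ × ℕ)
    (ins : Equiv.Perm (Fin n) × Fin (n + 1) → Equiv.Perm (Fin (n + 1)))
    (hins : Function.Injective ins) (Q : Equiv.Perm (Fin n) → Finset (Fin n))
    (hQ : ∀ σ, #(Q σ) = min n ((st σ).1 + s))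
    (hst : ∀ σ p, st' (ins (σ, p)) =
      ((st σ).1 + (if Raises (Q σ) p then 1 else 0), (st σ).2 + slotCode (Q σ) p))
    (F : ℕ × ℕ → ℕ) :
    ∑ τ, F (st' τ) = ∑ σ, ∑ c ∈ range (n + 1),
      F ((st σ).1 + (if c < (st σ).1 + s + 1 then 0 else 1), (st σ).2 + c) := by
  have hbij : Function.Bijective ins :=
    (Fintype.bijective_iff_injective_and_card ins).2
      ⟨hins, by simp [Fintype.card_perm, Nat.factorial_succ, mul_comm]⟩
  rw [← hbij.sum_comp, Fintype.sum_prod_type]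
  refine sum_congr rfl fun σ _ => ?_
  rw [← sum_slotCode (Q σ)]
  refine sum_congr rfl fun p _ => ?_
  rw [hst]
  have h1 := slotCode_lt_iff (Q σ) p
  have h2 := slotCode_lt (Q σ) p
  have h3 := hQ σ
  congr 2
  by_cases h : Raises (Q σ) p
  · simp only [h, not_true, iff_false] at h1
    rw [if_pos h, if_neg (by omega)]
  · simp only [h, not_false_eq_true, iff_true] at h1
    rw [if_neg h, if_pos (by omega)]

/-- The permutation of `[n+1]` with letter `x` at position `p` and the word `f` around it. -/
noncomputable def insertPerm {n : ℕ} (p x : Fin (n + 1)) (f : Fin n → Fin (n + 1))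
    (hf : Function.Injective f) (hx : ∀ j, f j ≠ x) : Equiv.Perm (Fin (n + 1)) :=
  Equiv.ofBijective (p.insertNth x f) <| Finite.injective_iff_bijective.1 <| by
    intro i j
    induction i using p.succAboveCases with
    | x => induction j using p.succAboveCases with
      | x => simp
      | p j => simpa using fun h => absurd h.symm (hx j)
    | p i => induction j using p.succAboveCases with
      | x => simpa using fun h => absurd h (hx i)
      | p j => simpa using fun h => hf h

section insertPerm

variable {n : ℕ} {p x : Fin (n + 1)} {f : Fin n → Fin (n + 1)} {hf : Function.Injective f}
  {hx : ∀ j, f j ≠ x}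

@[simp] theorem insertPerm_same : insertPerm p x f hf hx p = x := by
  simp [insertPerm]

@[simp] theorem insertPerm_succAbove (j : Fin n) :
    insertPerm p x f hf hx (p.succAbove j) = f j := by
  simp [insertPerm]

end insertPerm

theorem val_succAbove {n : ℕ} (p : Fin (n + 1)) (j : Fin n) :
    (p.succAbove j : ℕ) = j + if (p : ℕ) ≤ j then 1 else 0 := by
  unfold Fin.succAbove
  simp only [Fin.lt_def, Fin.val_castSucc]
  split_ifs <;> simp <;> omega

theorem card_pairs_succAbove {n : ℕ} (p : Fin (n + 1)) (R : Fin (n + 1) → Fin (n + 1) → Prop)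
    [DecidableRel R] (hpp : ¬ R p p) :
    #{q : Fin (n + 1) × Fin (n + 1) | R q.1 q.2}
      = #{j | R p (p.succAbove j)} + #{i | R (p.succAbove i) p}
        + #{q : Fin n × Fin n | R (p.succAbove q.1) (p.succAbove q.2)} := by
  simp only [card_filter, Fintype.sum_prod_type, Fin.sum_univ_succAbove _ p, sum_add_distrib, hpp,
    if_false]
  ring

theorem card_filter_val_le {n : ℕ} (a : ℕ) : #{j : Fin n | a ≤ (j : ℕ)} = n - a := by
  rw [card_filter, Fin.sum_univ_eq_sum_range (fun j => if a ≤ j then 1 else 0) n, ← card_filter,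
    ← Nat.card_Ico]
  congr 1
  ext j
  simp [and_comm]

/-- `j` is the lower position of an `(s+1)`-descent of `σ`. -/
def IsDescentBottom {n : ℕ} (s : ℕ) (σ : Equiv.Perm (Fin n)) (j : Fin n) : Prop :=
  ∃ i : Fin n, (i : ℕ) + 1 = j ∧ (σ j : ℕ) + s < σ i

instance {n : ℕ} (s : ℕ) (σ : Equiv.Perm (Fin n)) : DecidablePred (IsDescentBottom s σ) :=
  fun j => inferInstanceAs (Decidable (∃ i : Fin n, (i : ℕ) + 1 = j ∧ (σ j : ℕ) + s < σ i))

theorem IsDescentBottom.add_lt {n s : ℕ} {σ : Equiv.Perm (Fin n)} {j : Fin n}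
    (h : IsDescentBottom s σ j) : (σ j : ℕ) + s < n := by
  obtain ⟨i, -, hi⟩ := h
  omega

theorem mem_rdesPairs {n s : ℕ} {σ : Equiv.Perm (Fin n)} {q : Fin n × Fin n} :
    q ∈ rdesPairs (s + 1) σ ↔ (q.1 : ℕ) + 1 = q.2 ∧ (σ q.2 : ℕ) + s < σ q.1 := by
  rw [rdesPairs, mem_filter]
  simp only [pos1, val1, mem_univ, true_and]
  omega

theorem image_snd_rdesPairs {n : ℕ} (s : ℕ) (σ : Equiv.Perm (Fin n)) :
    (rdesPairs (s + 1) σ).image Prod.snd = univ.filter (IsDescentBottom s σ) := by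
  ext j
  simp only [mem_image, mem_rdesPairs, mem_filter, mem_univ, true_and, Prod.exists,
    exists_eq_right, IsDescentBottom]

theorem injOn_snd_rdesPairs {n : ℕ} (s : ℕ) (σ : Equiv.Perm (Fin n)) :
    Set.InjOn Prod.snd (rdesPairs (s + 1) σ : Set (Fin n × Fin n)) := by
  intro q hq q' hq' h
  rw [mem_coe, mem_rdesPairs] at hq hq'
  refine Prod.ext (Fin.ext ?_) h
  have := congrArg Fin.val h
  omega

theorem rdes_eq {n : ℕ} (s : ℕ) (σ : Equiv.Perm (Fin n)) :
    rdes (s + 1) σ = #{j | IsDescentBottom s σ j} := by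
  rw [rdes, ← image_snd_rdesPairs, card_image_of_injOn (injOn_snd_rdesPairs s σ)]

theorem rmaj_eq {n : ℕ} (s : ℕ) (σ : Equiv.Perm (Fin n)) :
    rmaj (s + 1) σ = ∑ j with IsDescentBottom s σ j, (j : ℕ)
      + #{q : Fin n × Fin n | q.1 < q.2 ∧ σ q.2 < σ q.1 ∧ (σ q.1 : ℕ) ≤ σ q.2 + s} := by
  rw [rmaj, ← image_snd_rdesPairs, sum_image (injOn_snd_rdesPairs s σ)]
  congr 1
  · refine sum_congr rfl fun q hq => ?_
    rw [mem_rdesPairs] at hq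
    exact hq.1
  · congr 1
    ext q
    simp only [val1, mem_filter, mem_univ, true_and, Fin.lt_def]
    omega

/-- Insertion of the letter `n+1` at position `p`. -/
noncomputable def maxInsert {n : ℕ} (σ : Equiv.Perm (Fin n)) (p : Fin (n + 1)) :
    Equiv.Perm (Fin (n + 1)) :=
  insertPerm p (Fin.last n) (fun j => (σ j).castSucc)
    ((Fin.castSucc_injective n).comp σ.injective) (fun _ => (Fin.castSucc_lt_last _).ne)

@[simp] theorem maxInsert_same {n : ℕ} (σ : Equiv.Perm (Fin n)) (p : Fin (n + 1)) :
    maxInsert σ p p = Fin.last n := by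
  simp [maxInsert]

@[simp] theorem maxInsert_succAbove {n : ℕ} (σ : Equiv.Perm (Fin n)) (p : Fin (n + 1))
    (j : Fin n) : maxInsert σ p (p.succAbove j) = (σ j).castSucc := by
  simp [maxInsert]

theorem maxInsert_injective {n : ℕ} :
    Function.Injective fun x : Equiv.Perm (Fin n) × Fin (n + 1) => maxInsert x.1 x.2 := by
  rintro ⟨σ, p⟩ ⟨σ', p'⟩ h
  dsimp only at h
  have hp : p = p' := by
    apply (maxInsert σ' p').injective
    rw [← h, maxInsert_same, h, maxInsert_same]
  subst hp
  congr 1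
  ext j
  have := congrArg (fun τ => τ (p.succAbove j)) h
  simpa [Fin.ext_iff] using this

theorem not_isDescentBottom_maxInsert_same {n : ℕ} (s : ℕ) (σ : Equiv.Perm (Fin n))
    (p : Fin (n + 1)) : ¬ IsDescentBottom s (maxInsert σ p) p := by
  rintro ⟨i, -, h⟩
  rw [maxInsert_same, Fin.val_last] at h
  omega

theorem isDescentBottom_maxInsert_succAbove {n : ℕ} (s : ℕ) (σ : Equiv.Perm (Fin n))
    (p : Fin (n + 1)) (j : Fin n) :
    IsDescentBottom s (maxInsert σ p) (p.succAbove j) ↔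
      if j.castSucc = p then (σ j : ℕ) + s < n else IsDescentBottom s σ j := by
  unfold IsDescentBottom
  rw [Fin.exists_iff_succAbove p]
  simp only [maxInsert_same, maxInsert_succAbove, val_succAbove, Fin.val_last, Fin.val_castSucc]
  by_cases hj : j.castSucc = p
  · subst hj
    simp only [Fin.val_castSucc, le_refl, if_true, true_and]
    refine ⟨?_, Or.inl⟩
    rintro (h | ⟨i, -, h⟩) <;> omega
  · have hjp : (j : ℕ) ≠ p := fun h => hj (Fin.ext h)
    rw [if_neg hj]
    constructor
    · rintro (⟨h, -⟩ | ⟨i, hi, h⟩)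
      · split_ifs at h <;> omega
      · refine ⟨i, ?_, h⟩
        split_ifs at hi <;> omega
    · rintro ⟨i, hi, h⟩
      refine Or.inr ⟨i, ?_, h⟩
      split_ifs <;> omega

/-- The slots, apart from the last one, at which inserting the largest letter creates no new
`(s+1)`-descent. -/
def desSlots {n : ℕ} (s : ℕ) (σ : Equiv.Perm (Fin n)) : Finset (Fin n) :=
  univ.filter fun j => IsDescentBottom s σ j ∨ n ≤ (σ j : ℕ) + s

theorem card_filter_desSlots {n : ℕ} (s : ℕ) (σ : Equiv.Perm (Fin n)) (P : Fin n → Prop)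
    [DecidablePred P] :
    #((desSlots s σ).filter P) =
      #{j | IsDescentBottom s σ j ∧ P j} + #{j | n ≤ (σ j : ℕ) + s ∧ P j} := by
  rw [← card_union_of_disjoint]
  · congr 1
    ext j
    simp only [desSlots, mem_filter, mem_univ, true_and, mem_union]
    tauto
  · rw [disjoint_filter]
    rintro j - ⟨h, -⟩ ⟨h', -⟩
    exact absurd h.add_lt (by omega)

theorem card_desSlots {n : ℕ} (s : ℕ) (σ : Equiv.Perm (Fin n)) :
    #(desSlots s σ) = min n (rdes (s + 1) σ + s) := by
  have h := card_filter_desSlots s σ fun _ => True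
  have hle : #(desSlots s σ) ≤ n := by simpa using card_le_univ (desSlots s σ)
  have hbig : #{j | n ≤ (σ j : ℕ) + s} = n - (n - s) := by
    rw [← card_filter_val_le (n := n) (n - s)]
    refine card_equiv σ fun j => ?_
    simp only [mem_filter, mem_univ, true_and]
    omega
  simp only [filter_true, and_true] at h
  rw [rdes_eq]
  by_cases hs : n ≤ s
  · omega
  · omega

theorem raises_desSlots_iff {n : ℕ} (s : ℕ) (σ : Equiv.Perm (Fin n)) (p : Fin (n + 1)) :
    Raises (desSlots s σ) p ↔
      ∃ j, ¬ IsDescentBottom s σ j ∧ (σ j : ℕ) + s < n ∧ j.castSucc = p := by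
  simp only [Raises, desSlots, mem_filter, mem_univ, true_and, not_or, not_le, and_assoc]

theorem sum_isDescentBottom_maxInsert {n : ℕ} (s : ℕ) (σ : Equiv.Perm (Fin n)) (p : Fin (n + 1))
    (g : ℕ → ℕ) :
    ∑ i with IsDescentBottom s (maxInsert σ p) i, g i =
      ∑ j with IsDescentBottom s σ j, g (j + if (p : ℕ) ≤ j then 1 else 0)
        + if Raises (desSlots s σ) p then g (p + 1) else 0 := by
  simp only [sum_filter, Fin.sum_univ_succAbove _ p, not_isDescentBottom_maxInsert_same, if_false,
    zero_add, val_succAbove, isDescentBottom_maxInsert_succAbove]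
  split_ifs with h
  · obtain ⟨k, hk, hlt, rfl⟩ := (raises_desSlots_iff s σ p).1 h
    rw [← add_sum_erase _ _ (mem_univ k), ← add_sum_erase _ _ (mem_univ k)]
    simp only [Fin.val_castSucc, le_refl, if_true, hlt, hk, if_false, zero_add]
    rw [add_comm]
    congr 1
    refine sum_congr rfl fun j hj => ?_
    simp only [Fin.castSucc_inj, ne_of_mem_erase hj, if_false]
  · rw [raises_desSlots_iff] at h
    rw [add_zero]
    refine sum_congr rfl fun j _ => ?_
    by_cases hj : j.castSucc = p
    · have : IsDescentBottom s σ j ↔ (σ j : ℕ) + s < n :=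
        ⟨fun h => h.add_lt, fun hlt => by_contra fun hb => h ⟨j, hb, hlt, hj⟩⟩
      simp only [hj, if_true, this]
    · simp only [hj, if_false]

theorem rdes_maxInsert {n : ℕ} (s : ℕ) (σ : Equiv.Perm (Fin n)) (p : Fin (n + 1)) :
    rdes (s + 1) (maxInsert σ p) =
      rdes (s + 1) σ + if Raises (desSlots s σ) p then 1 else 0 := by
  simpa only [rdes_eq, card_eq_sum_ones] using
    sum_isDescentBottom_maxInsert s σ p fun _ => 1

theorem rmaj_maxInsert {n : ℕ} (s : ℕ) (σ : Equiv.Perm (Fin n)) (p : Fin (n + 1)) :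
    rmaj (s + 1) (maxInsert σ p) = rmaj (s + 1) σ + slotCode (desSlots s σ) p := by
  rw [rmaj_eq, rmaj_eq, sum_isDescentBottom_maxInsert s σ p fun i => i, slotCode,
    card_filter_desSlots, card_pairs_succAbove p (fun i j => i < j ∧ maxInsert σ p j <
      maxInsert σ p i ∧ (maxInsert σ p i : ℕ) ≤ maxInsert σ p j + s) (by simp)]
  simp only [maxInsert_same, maxInsert_succAbove, Fin.succAbove_lt_succAbove_iff,
    Fin.castSucc_lt_castSucc_iff, Fin.val_castSucc, Fin.val_last, sum_add_distrib,
    Fin.castSucc_lt_last, true_and, not_lt_of_ge (Fin.le_last _), false_and, and_false,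
    filter_false, card_empty, add_zero]
  have h1 : ∑ j with IsDescentBottom s σ j, (if (p : ℕ) ≤ j then 1 else 0) =
      #{j | IsDescentBottom s σ j ∧ (p : ℕ) ≤ j} := by
    rw [← filter_filter, card_filter]
  have h2 : #{j | p < p.succAbove j ∧ n ≤ (σ j : ℕ) + s} =
      #{j | n ≤ (σ j : ℕ) + s ∧ (p : ℕ) ≤ j} := by
    congr 1
    ext j
    simp only [mem_filter, mem_univ, true_and, Fin.lt_def, val_succAbove]
    split_ifs <;> omega
  omega

/-- `i` is an `(s+1)`-excedance of `σ`. -/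
abbrev IsExc {n : ℕ} (s : ℕ) (σ : Equiv.Perm (Fin n)) (i : Fin n) : Prop :=
  (i : ℕ) + s < σ i

theorem rexc_eq {n : ℕ} (s : ℕ) (σ : Equiv.Perm (Fin n)) :
    rexc (s + 1) σ = #{i | IsExc s σ i} := by
  rw [rexc]
  congr 1
  ext i
  rw [mem_filter, mem_filter]
  simp only [pos1, val1, mem_univ, true_and]
  omega

theorem rden_eq {n : ℕ} (s : ℕ) (σ : Equiv.Perm (Fin n)) :
    rden (s + 1) σ = ∑ i with IsExc s σ i, ((i : ℕ) + s + 1)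
      + #{q : Fin n × Fin n | q.1 < q.2 ∧ IsExc s σ q.1 ∧ IsExc s σ q.2 ∧ σ q.2 < σ q.1}
      + #{q : Fin n × Fin n | q.1 < q.2 ∧ ¬ IsExc s σ q.1 ∧ ¬ IsExc s σ q.2 ∧ σ q.2 < σ q.1} := by
  have h (i : Fin n) : pos1 i + (s + 1) ≤ val1 σ i ↔ IsExc s σ i := by
    simp only [pos1, val1]
    omega
  simp only [rden, invOn, h]
  simp only [pos1, val1, Fin.lt_def, add_lt_add_iff_right]
  congr 2
  refine sum_congr rfl fun i _ => ?_
  omega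

/-- The least `(s+1)`-excedance letter of `σ` that is at least `t`, or `n` if there is none;
letters are counted from `0`. -/
def nextLetter {n : ℕ} (s : ℕ) (σ : Equiv.Perm (Fin n)) (t : ℕ) : ℕ :=
  Nat.find (p := fun e => (t ≤ e ∧ ∃ i, IsExc s σ i ∧ (σ i : ℕ) = e) ∨ e = n) ⟨n, Or.inr rfl⟩

section nextLetter

variable {n s : ℕ} {σ : Equiv.Perm (Fin n)} {t : ℕ} {i j : Fin n} {p : Fin (n + 1)}

theorem nextLetter_spec : (t ≤ nextLetter s σ t ∧ ∃ i, IsExc s σ i ∧ (σ i : ℕ) = nextLetter s σ t)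
    ∨ nextLetter s σ t = n :=
  Nat.find_spec (p := fun e => (t ≤ e ∧ ∃ i, IsExc s σ i ∧ (σ i : ℕ) = e) ∨ e = n) _

theorem nextLetter_le_size : nextLetter s σ t ≤ n :=
  Nat.find_le (Or.inr rfl)

theorem nextLetter_le (hi : IsExc s σ i) (ht : t ≤ σ i) : nextLetter s σ t ≤ σ i :=
  Nat.find_le (Or.inl ⟨ht, i, hi, rfl⟩)

theorem le_nextLetter (ht : t ≤ n) : t ≤ nextLetter s σ t := by
  rcases nextLetter_spec (s := s) (σ := σ) (t := t) with h | h <;> omega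

/-- The letter following the letter at position `j` among the excedance letters of `σ` and `n`,
if that letter is an excedance letter of size at least `p + s`; otherwise the letter itself. -/
def bump (s : ℕ) (σ : Equiv.Perm (Fin n)) (p : Fin (n + 1)) (j : Fin n) : Fin (n + 1) :=
  if IsExc s σ j ∧ (p : ℕ) + s ≤ σ j then
    ⟨nextLetter s σ (σ j + 1), Nat.lt_succ_of_le nextLetter_le_size⟩
  else (σ j).castSucc

theorem val_bump_of_le (hj : IsExc s σ j) (hp : (p : ℕ) + s ≤ σ j) :
    (bump s σ p j : ℕ) = nextLetter s σ (σ j + 1) := by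
  rw [bump, if_pos ⟨hj, hp⟩]

theorem bump_of_not_isExc (hj : ¬ IsExc s σ j) : bump s σ p j = (σ j).castSucc := by
  rw [bump, if_neg fun h => hj h.1]

theorem val_bump_of_not (hj : ¬ (IsExc s σ j ∧ (p : ℕ) + s ≤ σ j)) :
    (bump s σ p j : ℕ) = σ j := by
  rw [bump, if_neg hj, Fin.val_castSucc]

theorem lt_bump (hj : IsExc s σ j) (hp : (p : ℕ) + s ≤ σ j) : (σ j : ℕ) < bump s σ p j := by
  rw [val_bump_of_le hj hp]
  exact le_nextLetter (by omega)

theorem le_bump : (σ j : ℕ) ≤ bump s σ p j := by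
  by_cases h : IsExc s σ j ∧ (p : ℕ) + s ≤ σ j
  · exact (lt_bump h.1 h.2).le
  · exact (val_bump_of_not h).ge

theorem bump_spec (hj : IsExc s σ j) :
    (∃ i, IsExc s σ i ∧ (σ i : ℕ) = bump s σ p j) ∨ (bump s σ p j : ℕ) = n := by
  by_cases h : (p : ℕ) + s ≤ σ j
  · rw [val_bump_of_le hj h]
    exact nextLetter_spec.imp_left And.right
  · exact Or.inl ⟨j, hj, (val_bump_of_not fun h' => h h'.2).symm⟩

theorem bump_lt_bump (hi : IsExc s σ i) (hj : IsExc s σ j) (hij : σ i < σ j) :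
    bump s σ p i < bump s σ p j := by
  rw [Fin.lt_def] at hij ⊢
  by_cases h : (p : ℕ) + s ≤ σ i
  · have h1 := lt_bump (p := p) hj (by omega)
    have h2 := nextLetter_le (t := σ i + 1) hj hij
    rw [val_bump_of_le hi h]
    omega
  · rw [val_bump_of_not fun h' => h h'.2]
    exact hij.trans_le le_bump

theorem bump_lt_bump_iff (hi : IsExc s σ i) (hj : IsExc s σ j) :
    bump s σ p i < bump s σ p j ↔ σ i < σ j := by
  refine ⟨fun h => ?_, bump_lt_bump hi hj⟩
  by_contra hn
  rcases (not_lt.1 hn).lt_or_eq with h' | h'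
  · exact (bump_lt_bump hj hi h').asymm h
  · rw [σ.injective h'] at h
    exact h.false

theorem bump_ne_bump (hi : IsExc s σ i ∧ (p : ℕ) + s ≤ σ i)
    (hj : ¬ (IsExc s σ j ∧ (p : ℕ) + s ≤ σ j)) : bump s σ p i ≠ bump s σ p j := by
  intro h
  have h := congrArg Fin.val h
  have hlt := lt_bump hi.1 hi.2
  rw [val_bump_of_not hj] at h
  rcases bump_spec (p := p) hi.1 with ⟨k, hk, hk'⟩ | h'
  · have : k = j := σ.injective (Fin.ext (hk'.trans h))
    subst this
    exact hj ⟨hk, by omega⟩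
  · omega

theorem bump_injective : Function.Injective (bump s σ p) := by
  intro i j h
  by_cases hi : IsExc s σ i ∧ (p : ℕ) + s ≤ σ i <;>
    by_cases hj : IsExc s σ j ∧ (p : ℕ) + s ≤ σ j
  · rcases lt_trichotomy (σ i) (σ j) with h' | h' | h'
    · exact absurd h (bump_lt_bump hi.1 hj.1 h').ne
    · exact σ.injective h'
    · exact absurd h (bump_lt_bump hj.1 hi.1 h').ne'
  · exact absurd h (bump_ne_bump hi hj)
  · exact absurd h.symm (bump_ne_bump hj hi)
  · have h := congrArg Fin.val h
    rw [val_bump_of_not hi, val_bump_of_not hj] at h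
    exact σ.injective (Fin.ext h)

theorem bump_ne_nextLetter :
    bump s σ p j ≠ ⟨nextLetter s σ (p + s), Nat.lt_succ_of_le nextLetter_le_size⟩ := by
  intro h
  have h : (bump s σ p j : ℕ) = nextLetter s σ (p + s) := congrArg Fin.val h
  by_cases hj : IsExc s σ j ∧ (p : ℕ) + s ≤ σ j
  · have h1 := lt_bump hj.1 hj.2
    have h2 := nextLetter_le hj.1 hj.2
    omega
  · rw [val_bump_of_not hj] at h
    rcases nextLetter_spec (s := s) (σ := σ) (t := p + s) with ⟨hle, k, hk, hk'⟩ | h'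
    · have : k = j := σ.injective (Fin.ext (hk'.trans h.symm))
      subst this
      exact hj ⟨hk, by omega⟩
    · omega

/-- Insertion of the excedance letter `nextLetter s σ (p + s)` at position `p`, all the excedance
letters that are at least as large being replaced by their successors. -/
noncomputable def excInsert (s : ℕ) (σ : Equiv.Perm (Fin n)) (p : Fin (n + 1)) :
    Equiv.Perm (Fin (n + 1)) :=
  insertPerm p ⟨nextLetter s σ (p + s), Nat.lt_succ_of_le nextLetter_le_size⟩ (bump s σ p)
    bump_injective (fun _ => bump_ne_nextLetter)

theorem val_excInsert_same : (excInsert s σ p p : ℕ) = nextLetter s σ (p + s) := by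
  simp [excInsert]

@[simp] theorem excInsert_succAbove :
    excInsert s σ p (p.succAbove j) = bump s σ p j := by
  simp [excInsert]

theorem isExc_excInsert_succAbove : IsExc s (excInsert s σ p) (p.succAbove j) ↔ IsExc s σ j := by
  rw [IsExc, excInsert_succAbove, val_succAbove]
  by_cases hj : IsExc s σ j
  · simp only [hj, iff_true]
    have h1 := le_bump (s := s) (σ := σ) (p := p) (j := j)
    split_ifs with h
    · have := lt_bump (p := p) hj (by omega)
      omega
    · omega
  · simp only [hj, iff_false]
    rw [bump_of_not_isExc hj, Fin.val_castSucc]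
    omega

theorem nextLetter_image :
    insert n ((univ.filter (IsExc s σ)).image fun i => (σ i : ℕ)) =
      insert (nextLetter s σ (p + s))
        ((univ.filter (IsExc s σ)).image fun i => (bump s σ p i : ℕ)) := by
  symm
  apply eq_of_subset_of_card_le
  · intro e he
    simp only [mem_insert, mem_image, mem_filter, mem_univ, true_and] at he ⊢
    rcases he with rfl | ⟨i, hi, rfl⟩
    · exact nextLetter_spec.symm.imp_right And.right
    · exact (bump_spec hi).symm
  · refine (card_insert_le _ _).trans ?_
    rw [card_insert_of_notMem, card_image_of_injective, card_image_of_injective]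
    · exact Fin.val_injective.comp bump_injective
    · exact Fin.val_injective.comp σ.injective
    · rintro h
      obtain ⟨i, -, hi⟩ := mem_image.1 h
      exact bump_ne_nextLetter (Fin.ext hi)

theorem exists_bump_eq (hi : IsExc s σ i) :
    (σ i : ℕ) = nextLetter s σ (p + s) ∨ ∃ j, IsExc s σ j ∧ (bump s σ p j : ℕ) = σ i := by
  have h : (σ i : ℕ) ∈ insert n ((univ.filter (IsExc s σ)).image fun i => (σ i : ℕ)) :=
    mem_insert_of_mem (mem_image_of_mem _ (by simpa using hi))
  rw [nextLetter_image (p := p)] at h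
  simpa using h

theorem nextLetter_congr {σ' : Equiv.Perm (Fin n)}
    (h : ∀ e, (∃ i, IsExc s σ i ∧ (σ i : ℕ) = e) ↔ ∃ i, IsExc s σ' i ∧ (σ' i : ℕ) = e) (t : ℕ) :
    nextLetter s σ t = nextLetter s σ' t := by
  simp only [nextLetter, h]

end nextLetter

theorem excInsert_ne_of_lt {n : ℕ} (s : ℕ) (σ σ' : Equiv.Perm (Fin n)) {p p' : Fin (n + 1)}
    (hpp : p < p') : excInsert s σ p ≠ excInsert s σ' p' := by
  intro h
  obtain ⟨j, hj⟩ := Fin.exists_succAbove_eq hpp.ne'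
  have hjp : (j : ℕ) + 1 = p' := by
    have h1 := val_succAbove p j
    rw [hj] at h1
    rw [Fin.lt_def] at hpp
    split_ifs at h1 <;> omega
  have hlt : (p : ℕ) < p' := hpp
  have hval : (bump s σ p j : ℕ) = nextLetter s σ' (p' + s) := by
    rw [← val_excInsert_same, ← h, ← hj, excInsert_succAbove]
  by_cases hexc : IsExc s σ j
  · have hexc' : (j : ℕ) + s < σ j := hexc
    have hbump := lt_bump (p := p) hexc (by omega)
    obtain ⟨m, hm, hmj⟩ : ∃ m, IsExc s (excInsert s σ p) m ∧ (excInsert s σ p m : ℕ) = σ j := by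
      rcases exists_bump_eq (p := p) hexc with he | ⟨i, hi, he⟩
      · refine ⟨p, ?_, by rw [val_excInsert_same, he]⟩
        rw [IsExc, val_excInsert_same]
        omega
      · exact ⟨p.succAbove i, isExc_excInsert_succAbove.2 hi, by rw [excInsert_succAbove, he]⟩
    rw [h] at hm hmj
    have hne : m ≠ p' := by
      rintro rfl
      rw [val_excInsert_same] at hmj
      omega
    obtain ⟨k, rfl⟩ := Fin.exists_succAbove_eq hne
    rw [isExc_excInsert_succAbove] at hm
    rw [excInsert_succAbove] at hmj
    rcases bump_spec (p := p') hm with ⟨i, hi, he⟩ | he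
    · have := nextLetter_le (t := p' + s) hi (by omega)
      omega
    · omega
  · rw [bump_of_not_isExc hexc, Fin.val_castSucc] at hval
    rcases nextLetter_spec (s := s) (σ := σ') (t := p' + s) with h' | h' <;> omega

theorem excInsert_left_injective {n : ℕ} (s : ℕ) (p : Fin (n + 1)) :
    Function.Injective fun σ : Equiv.Perm (Fin n) => excInsert s σ p := by
  intro σ σ' h
  dsimp only at h
  have hbump (j : Fin n) : bump s σ p j = bump s σ' p j := by
    rw [← excInsert_succAbove, h, excInsert_succAbove]
  have hexc (j : Fin n) : IsExc s σ j ↔ IsExc s σ' j := by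
    rw [← isExc_excInsert_succAbove (p := p), h, isExc_excInsert_succAbove]
  have hnext : nextLetter s σ (p + s) = nextLetter s σ' (p + s) := by
    rw [← val_excInsert_same, h, val_excInsert_same]
  have hset : insert n ((univ.filter (IsExc s σ)).image fun i => (σ i : ℕ)) =
      insert n ((univ.filter (IsExc s σ')).image fun i => (σ' i : ℕ)) := by
    rw [nextLetter_image (p := p), nextLetter_image (p := p), hnext]
    simp only [hbump, hexc]
  have hletter (e : ℕ) :
      (∃ i, IsExc s σ i ∧ (σ i : ℕ) = e) ↔ ∃ i, IsExc s σ' i ∧ (σ' i : ℕ) = e := by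
    have hmem := Finset.ext_iff.1 hset e
    simp only [mem_insert, mem_image, mem_filter, mem_univ, true_and] at hmem
    constructor <;> rintro ⟨i, hi, rfl⟩
    · exact (hmem.1 (Or.inr ⟨i, hi, rfl⟩)).resolve_left (by omega)
    · exact (hmem.2 (Or.inr ⟨i, hi, rfl⟩)).resolve_left (by omega)
  ext j
  by_cases hj : IsExc s σ j
  · obtain ⟨i, hi, he⟩ := (hletter (σ j)).1 ⟨j, hj, rfl⟩
    have : bump s σ' p i = bump s σ' p j := by
      rw [← hbump j]
      simp only [bump, hi, hj, nextLetter_congr hletter, Fin.ext he]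
    rw [← he, bump_injective this]
  · have := hbump j
    rw [bump_of_not_isExc hj, bump_of_not_isExc (mt (hexc j).2 hj)] at this
    simpa [Fin.ext_iff] using this

theorem excInsert_injective {n : ℕ} (s : ℕ) :
    Function.Injective fun x : Equiv.Perm (Fin n) × Fin (n + 1) => excInsert s x.1 x.2 := by
  rintro ⟨σ, p⟩ ⟨σ', p'⟩ h
  dsimp only at h
  rcases lt_trichotomy p p' with hp | rfl | hp
  · exact absurd h (excInsert_ne_of_lt s σ σ' hp)
  · rw [excInsert_left_injective s p h]
  · exact absurd h.symm (excInsert_ne_of_lt s σ' σ hp)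

/-- The slots, apart from the last one, at which `excInsert` creates no new `(s+1)`-excedance. -/
def excSlots {n : ℕ} (s : ℕ) (σ : Equiv.Perm (Fin n)) : Finset (Fin n) :=
  univ.filter fun j => n ≤ (j : ℕ) + s ∨ ∃ i, IsExc s σ i ∧ (σ i : ℕ) = j + s

theorem card_filter_excSlots {n : ℕ} (s : ℕ) (σ : Equiv.Perm (Fin n)) (a : ℕ) :
    #((excSlots s σ).filter fun j : Fin n => a ≤ (j : ℕ)) =
      (n - max a (n - s)) + #{i | IsExc s σ i ∧ a + s ≤ σ i} := by
  have h1 : #{i | IsExc s σ i ∧ a + s ≤ σ i} =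
      #{j : Fin n | (∃ i, IsExc s σ i ∧ (σ i : ℕ) = j + s) ∧ a ≤ (j : ℕ)} := by
    refine card_bij (fun i _ => ⟨σ i - s, by omega⟩) ?_ ?_ ?_
    · intro i hi
      simp only [mem_filter, mem_univ, true_and] at hi ⊢
      exact ⟨⟨i, hi.1, by omega⟩, by omega⟩
    · intro i hi i' hi' h
      simp only [mem_filter, mem_univ, true_and, Fin.mk.injEq] at hi hi' h
      exact σ.injective (Fin.ext (by omega))
    · intro j hj
      simp only [mem_filter, mem_univ, true_and] at hj
      obtain ⟨⟨i, hi, he⟩, ha⟩ := hj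
      refine ⟨i, ?_, Fin.ext (by simp only; omega)⟩
      simp only [mem_filter, mem_univ, true_and]
      exact ⟨hi, by omega⟩
  rw [h1, ← card_filter_val_le, ← card_union_of_disjoint]
  · congr 1
    ext j
    simp only [excSlots, mem_filter, mem_univ, true_and, mem_union]
    grind
  · rw [disjoint_filter]
    rintro j - h ⟨⟨i, -, he⟩, -⟩
    omega

theorem card_excSlots {n : ℕ} (s : ℕ) (σ : Equiv.Perm (Fin n)) :
    #(excSlots s σ) = min n (rexc (s + 1) σ + s) := by
  have h := card_filter_excSlots s σ 0
  have hle : #(excSlots s σ) ≤ n := by simpa using card_le_univ (excSlots s σ)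
  have hexc : #{i | IsExc s σ i ∧ 0 + s ≤ σ i} = #{i | IsExc s σ i} := by
    congr 1
    ext i
    simp only [mem_filter, mem_univ, true_and]
    omega
  simp only [Nat.zero_le, filter_true] at h
  rw [rexc_eq]
  omega

section excInsert

variable {n : ℕ} (s : ℕ) (σ : Equiv.Perm (Fin n)) (p : Fin (n + 1))

theorem raises_excSlots_iff : Raises (excSlots s σ) p ↔ IsExc s (excInsert s σ p) p := by
  rw [IsExc, val_excInsert_same]
  simp only [Raises, excSlots, mem_filter, mem_univ, true_and, not_or, not_le]
  constructor
  · rintro ⟨j, ⟨hj, hne⟩, rfl⟩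
    rw [Fin.val_castSucc]
    rcases nextLetter_spec (s := s) (σ := σ) (t := j + s) with ⟨hle, i, hi, he⟩ | h
    · refine hle.lt_of_ne fun h => hne ⟨i, hi, ?_⟩
      omega
    · omega
  · intro h
    have hle := nextLetter_le_size (s := s) (σ := σ) (t := p + s)
    refine ⟨⟨p, by omega⟩, ⟨by simp only; omega, ?_⟩, rfl⟩
    rintro ⟨i, hi, he⟩
    have := nextLetter_le (t := p + s) hi he.ge
    simp only at he
    omega

theorem rexc_excInsert :
    rexc (s + 1) (excInsert s σ p) =
      rexc (s + 1) σ + if Raises (excSlots s σ) p then 1 else 0 := by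
  simp only [rexc_eq, card_filter, Fin.sum_univ_succAbove _ p, isExc_excInsert_succAbove,
    raises_excSlots_iff]
  omega

theorem sum_isExc_excInsert :
    ∑ i with IsExc s (excInsert s σ p) i, ((i : ℕ) + s + 1) =
      ∑ j with IsExc s σ j, ((j : ℕ) + s + 1) + #{j | IsExc s σ j ∧ (p : ℕ) ≤ j}
        + if IsExc s (excInsert s σ p) p then (p : ℕ) + s + 1 else 0 := by
  rw [← filter_filter, card_filter, ← sum_add_distrib]
  simp only [sum_filter, Fin.sum_univ_succAbove _ p, isExc_excInsert_succAbove, val_succAbove]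
  rw [add_comm]
  congr 1
  refine sum_congr rfl fun j _ => ?_
  split_ifs <;> omega

theorem card_exc_inversions_excInsert :
    #{q : Fin (n + 1) × Fin (n + 1) | q.1 < q.2 ∧ IsExc s (excInsert s σ p) q.1 ∧
        IsExc s (excInsert s σ p) q.2 ∧ excInsert s σ p q.2 < excInsert s σ p q.1} =
      #{q : Fin n × Fin n | q.1 < q.2 ∧ IsExc s σ q.1 ∧ IsExc s σ q.2 ∧ σ q.2 < σ q.1}
        + if IsExc s (excInsert s σ p) p then
            #{i | IsExc s σ i ∧ p + s ≤ σ i ∧ (i : ℕ) < p} else 0 := by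
  rw [card_pairs_succAbove p (fun i j => i < j ∧ IsExc s (excInsert s σ p) i ∧
    IsExc s (excInsert s σ p) j ∧ excInsert s σ p j < excInsert s σ p i) (by simp)]
  simp only [isExc_excInsert_succAbove, excInsert_succAbove, Fin.succAbove_lt_succAbove_iff]
  have h1 : #{j | p < p.succAbove j ∧ IsExc s (excInsert s σ p) p ∧ IsExc s σ j ∧
      bump s σ p j < excInsert s σ p p} = 0 := by
    rw [card_eq_zero, filter_eq_empty_iff]
    rintro j - ⟨hpj, -, hj, hlt⟩
    rw [Fin.lt_def, val_excInsert_same] at hlt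
    rw [Fin.lt_def, val_succAbove] at hpj
    have hb := le_bump (s := s) (σ := σ) (p := p) (j := j)
    have := nextLetter_le (t := p + s) hj (by split_ifs at hpj <;> omega)
    omega
  have h2 : #{i | p.succAbove i < p ∧ IsExc s σ i ∧ IsExc s (excInsert s σ p) p ∧
      excInsert s σ p p < bump s σ p i} = if IsExc s (excInsert s σ p) p then
            #{i | IsExc s σ i ∧ p + s ≤ σ i ∧ (i : ℕ) < p} else 0 := by
    split_ifs with hp
    · congr 1
      ext i
      simp only [mem_filter, mem_univ, true_and, hp]
      rw [IsExc, val_excInsert_same] at hp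
      rw [Fin.lt_def, Fin.lt_def, val_succAbove, val_excInsert_same]
      constructor
      · rintro ⟨hip, hi, hlt⟩
        refine ⟨hi, ?_, by split_ifs at hip <;> omega⟩
        by_contra hn
        rw [val_bump_of_not fun h => hn h.2] at hlt
        omega
      · rintro ⟨hi, hle, hip⟩
        refine ⟨by split_ifs <;> omega, hi, ?_⟩
        exact (nextLetter_le hi hle).trans_lt (lt_bump hi hle)
    · simp [hp]
  have h3 : #{q : Fin n × Fin n | q.1 < q.2 ∧ IsExc s σ q.1 ∧ IsExc s σ q.2 ∧
      bump s σ p q.2 < bump s σ p q.1} =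
      #{q : Fin n × Fin n | q.1 < q.2 ∧ IsExc s σ q.1 ∧ IsExc s σ q.2 ∧ σ q.2 < σ q.1} := by
    congr 1
    refine filter_congr fun q _ => ?_
    refine and_congr_right fun _ => and_congr_right fun h1 => and_congr_right fun h2 => ?_
    exact bump_lt_bump_iff h2 h1
  omega

theorem card_nexc_inversions_excInsert :
    #{q : Fin (n + 1) × Fin (n + 1) | q.1 < q.2 ∧ ¬ IsExc s (excInsert s σ p) q.1 ∧
        ¬ IsExc s (excInsert s σ p) q.2 ∧ excInsert s σ p q.2 < excInsert s σ p q.1} =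
      #{q : Fin n × Fin n | q.1 < q.2 ∧ ¬ IsExc s σ q.1 ∧ ¬ IsExc s σ q.2 ∧ σ q.2 < σ q.1}
        + if IsExc s (excInsert s σ p) p then 0 else
            #{j | ¬ IsExc s σ j ∧ (σ j : ℕ) < nextLetter s σ (p + s) ∧ (p : ℕ) ≤ j} := by
  rw [card_pairs_succAbove p (fun i j => i < j ∧ ¬ IsExc s (excInsert s σ p) i ∧
    ¬ IsExc s (excInsert s σ p) j ∧ excInsert s σ p j < excInsert s σ p i) (by simp)]
  simp only [isExc_excInsert_succAbove, excInsert_succAbove, Fin.succAbove_lt_succAbove_iff]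
  have h1 : #{j | p < p.succAbove j ∧ ¬ IsExc s (excInsert s σ p) p ∧ ¬ IsExc s σ j ∧
      bump s σ p j < excInsert s σ p p} = if IsExc s (excInsert s σ p) p then 0 else
            #{j | ¬ IsExc s σ j ∧ (σ j : ℕ) < nextLetter s σ (p + s) ∧ (p : ℕ) ≤ j} := by
    split_ifs with hp
    · simp [hp]
    · congr 1
      refine filter_congr fun j _ => ?_
      rw [Fin.lt_def, Fin.lt_def, val_succAbove, val_excInsert_same]
      by_cases hj : IsExc s σ j
      · simp only [hj, not_true, false_and, and_false]
      · rw [bump_of_not_isExc hj, Fin.val_castSucc]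
        simp only [hp, hj, not_false_eq_true, true_and]
        split_ifs <;> omega
  have h2 : #{i | p.succAbove i < p ∧ ¬ IsExc s σ i ∧ ¬ IsExc s (excInsert s σ p) p ∧
      excInsert s σ p p < bump s σ p i} = 0 := by
    rw [card_eq_zero, filter_eq_empty_iff]
    rintro i - ⟨hip, hi, -, hlt⟩
    rw [bump_of_not_isExc hi, Fin.lt_def, val_excInsert_same, Fin.val_castSucc] at hlt
    rw [Fin.lt_def, val_succAbove] at hip
    rcases nextLetter_spec (s := s) (σ := σ) (t := p + s) with h | h <;>
      split_ifs at hip <;> omega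
  have h3 : #{q : Fin n × Fin n | q.1 < q.2 ∧ ¬ IsExc s σ q.1 ∧ ¬ IsExc s σ q.2 ∧
      bump s σ p q.2 < bump s σ p q.1} =
      #{q : Fin n × Fin n | q.1 < q.2 ∧ ¬ IsExc s σ q.1 ∧ ¬ IsExc s σ q.2 ∧ σ q.2 < σ q.1} := by
    congr 1
    refine filter_congr fun q _ => ?_
    refine and_congr_right fun _ => and_congr_right fun h1 => and_congr_right fun h2 => ?_
    rw [bump_of_not_isExc h1, bump_of_not_isExc h2, Fin.castSucc_lt_castSucc_iff]
  omega

theorem rden_excInsert :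
    rden (s + 1) (excInsert s σ p) = rden (s + 1) σ + slotCode (excSlots s σ) p := by
  rw [rden_eq, rden_eq, sum_isExc_excInsert, card_exc_inversions_excInsert,
    card_nexc_inversions_excInsert, slotCode, card_filter_excSlots]
  simp only [raises_excSlots_iff]
  split_ifs with hp
  · rw [IsExc, val_excInsert_same] at hp
    have hle := nextLetter_le_size (s := s) (σ := σ) (t := p + s)
    have h := card_filter_add_card_filter_not (s := univ.filter fun i => IsExc s σ i ∧ p + s ≤ σ i)
      (fun i => (i : ℕ) < p)
    rw [filter_filter, filter_filter] at h
    have h1 : #{i | (IsExc s σ i ∧ p + s ≤ σ i) ∧ ¬ (i : ℕ) < p} =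
        #{j | IsExc s σ j ∧ (p : ℕ) ≤ j} := by
      congr 1
      refine filter_congr fun i _ => ?_
      omega
    simp only [and_assoc] at h h1
    omega
  · rw [IsExc, val_excInsert_same] at hp
    have hpn := p.isLt
    have hx : nextLetter s σ (p + s) = min (p + s) n := by
      rcases nextLetter_spec (s := s) (σ := σ) (t := p + s) with h | h
      · have := nextLetter_le_size (s := s) (σ := σ) (t := p + s)
        omega
      · omega
    have h1 := card_filter_add_card_filter_not (s := univ.filter fun j : Fin n => (p : ℕ) ≤ j)
      (IsExc s σ)
    have h2 := card_filter_add_card_filter_not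
      (s := univ.filter fun j : Fin n => (p : ℕ) ≤ j ∧ ¬ IsExc s σ j)
      (fun j => (σ j : ℕ) < nextLetter s σ (p + s))
    have h3 := card_filter_add_card_filter_not
      (s := univ.filter fun j : Fin n => nextLetter s σ (p + s) ≤ σ j) (IsExc s σ)
    have h4 : #{j | nextLetter s σ (p + s) ≤ (σ j : ℕ)} = n - nextLetter s σ (p + s) := by
      rw [← card_filter_val_le]
      exact card_equiv σ fun j => by simp only [mem_filter, mem_univ, true_and]
    rw [card_filter_val_le] at h1
    rw [h4] at h3
    simp only [filter_filter] at h1 h2 h3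
    have h5 : #{j : Fin n | (p : ℕ) ≤ j ∧ IsExc s σ j} = #{j | IsExc s σ j ∧ (p : ℕ) ≤ j} := by
      simp only [and_comm]
    have h6 : #{j : Fin n | ((p : ℕ) ≤ j ∧ ¬ IsExc s σ j) ∧ (σ j : ℕ) < nextLetter s σ (p + s)} =
        #{j | ¬ IsExc s σ j ∧ (σ j : ℕ) < nextLetter s σ (p + s) ∧ (p : ℕ) ≤ j} := by
      congr 1
      refine filter_congr fun j _ => ?_
      tauto
    have h7 : #{j : Fin n | ((p : ℕ) ≤ j ∧ ¬ IsExc s σ j) ∧ ¬ (σ j : ℕ) < nextLetter s σ (p + s)} =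
        #{j | nextLetter s σ (p + s) ≤ (σ j : ℕ) ∧ ¬ IsExc s σ j} := by
      congr 1
      refine filter_congr fun j _ => ?_
      omega
    have h8 : #{j | nextLetter s σ (p + s) ≤ (σ j : ℕ) ∧ IsExc s σ j} =
        #{j | IsExc s σ j ∧ p + s ≤ (σ j : ℕ)} := by
      congr 1
      refine filter_congr fun j _ => ?_
      omega
    omega

end excInsert

theorem sum_rdes_rmaj_eq_sum_rexc_rden (s n : ℕ) : ∀ F : ℕ × ℕ → ℕ,
    ∑ σ : Equiv.Perm (Fin n), F (rdes (s + 1) σ, rmaj (s + 1) σ) =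
      ∑ σ : Equiv.Perm (Fin n), F (rexc (s + 1) σ, rden (s + 1) σ) := by
  induction n with
  | zero =>
    intro F
    refine sum_congr rfl fun σ _ => ?_
    simp [rdes_eq, rmaj_eq, rexc_eq, rden_eq]
  | succ n ih =>
    intro F
    rw [sum_stat_succ (s := s) (fun σ => (rdes (s + 1) σ, rmaj (s + 1) σ)) _ _
        maxInsert_injective (desSlots s) (card_desSlots s)
        (fun σ p => Prod.ext (rdes_maxInsert s σ p) (rmaj_maxInsert s σ p)) F,
      sum_stat_succ (s := s) (fun σ => (rexc (s + 1) σ, rden (s + 1) σ)) _ _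
        (excInsert_injective s) (excSlots s) (card_excSlots s)
        (fun σ p => Prod.ext (rexc_excInsert s σ p) (rden_excInsert s σ p)) F]
    exact ih fun w => ∑ c ∈ range (n + 1),
      F (w.1 + (if c < w.1 + s + 1 then 0 else 1), w.2 + c)

/-- `(rdes, rmaj)` and `(rexc, rden)` are equidistributed over `S_n`. -/
theorem rdes_rmaj_equidistributed_rexc_rden (r n : ℕ) (hr : 1 ≤ r) (hn : 1 ≤ n) (a b : ℕ) :
    ((univ : Finset (Equiv.Perm (Fin n))).filter fun σ =>
        rdes r σ = a ∧ rmaj r σ = b).card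
      = ((univ : Finset (Equiv.Perm (Fin n))).filter fun σ =>
          rexc r σ = a ∧ rden r σ = b).card := by
  obtain ⟨s, rfl⟩ := Nat.exists_eq_add_of_le' hr
  simpa only [card_filter, Prod.mk.injEq] using
    sum_rdes_rmaj_eq_sum_rexc_rden s n fun w => if w = (a, b) then 1 else 0

end PaperStmt
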